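/- Let ψ_p, ω_p, ϱ_p : X → (0, ∞) be bounded measurable twisting functions for p = 0, …, n. Then the average acceptance rates of a rejection sampler for the ω-twisted kernels using the ϱ-twisted kernels as proposals, within the ω-twisted model, can be expressed with respect to the ψ-twisted model as: α_0^{ω,ϱ} := M_0^ϱ(ω_0/ϱ_0) = M_0(ω_0)/M_0(ϱ_0), and for each p ∈ {1, …, n}, α_p^{ω,ϱ} := η̂_{p-1}^ω(M_p^ϱ(ω_p/ϱ_p)) = η̂_{p-1}^ψ( M_p(ω_p)² / (M_p(ψ_p) · M_p(ϱ_p)) ) / η̂_{p-1}^ψ( M_p(ω_p)/M_p(ψ_p) ). -/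

import Mathlib

open MeasureTheory ProbabilityTheory ENNReal

noncomputable section

/-- A bounded, strictly positive, measurable `ℝ≥0∞`-valued function
(a potential or twisting function with values in `(0, ∞)`). -/
def BddPos {X : Type*} [MeasurableSpace X] (f : X → ℝ≥0∞) : Prop :=
  Measurable f ∧ (∀ x, 0 < f x) ∧ ∃ C : ℝ≥0∞, C ≠ ⊤ ∧ ∀ x, f x ≤ C

/-- Predictive marginal measures `γ_p` of a Feynman–Kac model:
`γ_0 = M_0`, `γ_{p+1}(S) = ∫ γ_p(dx) G_p(x) M_{p+1}(x, S)`. -/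
def fkGamma {X : Type*} [MeasurableSpace X] (M0 : Measure X)
    (M : ℕ → X → Measure X) (G : ℕ → X → ℝ≥0∞) : ℕ → Measure X
  | 0 => M0
  | p + 1 => ((fkGamma M0 M G p).withDensity (G p)).bind (M (p + 1))

/-- Updated marginal measures `γ̂_p(S) = ∫_S G_p(x) γ_p(dx)`. -/
def fkGammaHat {X : Type*} [MeasurableSpace X] (M0 : Measure X)
    (M : ℕ → X → Measure X) (G : ℕ → X → ℝ≥0∞) (p : ℕ) : Measure X :=
  (fkGamma M0 M G p).withDensity (G p)

/-- The twist of a measure `μ` by a function `ψ` : `μ^ψ(dx) = μ(dx) ψ(x) / μ(ψ)`. -/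
def fkTwist {X : Type*} [MeasurableSpace X] (μ : Measure X) (ψ : X → ℝ≥0∞) : Measure X :=
  (∫⁻ y, ψ y ∂μ)⁻¹ • μ.withDensity ψ

/-- The `ψ`-twisted potential functions `G_p^ψ` for a model with terminal time `n`:
`G_0^ψ = (G_0/ψ_0) M_1(ψ_1) M_0(ψ_0)`, `G_p^ψ = (G_p/ψ_p) M_{p+1}(ψ_{p+1})` for
`1 ≤ p ≤ n-1`, and `G_n^ψ = G_n/ψ_n`. -/
def fkTwG {X : Type*} [MeasurableSpace X] (n : ℕ) (M0 : Measure X)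
    (M : ℕ → X → Measure X) (G ψ : ℕ → X → ℝ≥0∞) (p : ℕ) (x : X) : ℝ≥0∞ :=
  G p x * (ψ p x)⁻¹ *
    (if p < n then ∫⁻ y, ψ (p + 1) y ∂(M (p + 1) x) else 1) *
    (if p = 0 then ∫⁻ y, ψ 0 y ∂M0 else 1)

/-- Normalisation of a (finite, nonzero) measure. -/
def fkNorm {X : Type*} [MeasurableSpace X] (μ : Measure X) : Measure X :=
  (μ Set.univ)⁻¹ • μ

/-- The integral of a strictly positive bounded function against a probability measure is
positive and finite. -/
lemma BddPos.lintegral_ne {X : Type*} [MeasurableSpace X] {μ : Measure X} [IsFiniteMeasure μ]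
    (hμ : μ ≠ 0) {f : X → ℝ≥0∞} (hf : BddPos f) : ∫⁻ x, f x ∂μ ≠ 0 ∧ ∫⁻ x, f x ∂μ ≠ ⊤ := by
  obtain ⟨hm, hpos, C, hC, hle⟩ := hf
  refine ⟨fun h => hμ ?_, ?_⟩
  · rw [lintegral_eq_zero_iff hm] at h
    refine ae_eq_bot.mp (Filter.eventually_false_iff_eq_bot.mp ?_)
    filter_upwards [h] with x hx using (hpos x).ne' hx
  · refine ne_top_of_le_ne_top (ENNReal.mul_ne_top hC (measure_ne_top μ Set.univ)) ?_
    exact (lintegral_mono hle).trans_eq (lintegral_const C)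

lemma BddPos.ne_zero {X : Type*} [MeasurableSpace X] {f : X → ℝ≥0∞} (hf : BddPos f) (x : X) :
    f x ≠ 0 := (hf.2.1 x).ne'

lemma BddPos.ne_top {X : Type*} [MeasurableSpace X] {f : X → ℝ≥0∞} (hf : BddPos f) (x : X) :
    f x ≠ ⊤ := by
  obtain ⟨-, -, C, hC, hle⟩ := hf
  exact ne_top_of_le_ne_top hC (hle x)

/-- A Markov kernel maps bounded positive functions to bounded positive functions. -/
lemma BddPos.lintegral_kernel {X : Type*} [MeasurableSpace X] (κ : Kernel X X) [IsMarkovKernel κ]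
    {f : X → ℝ≥0∞} (hf : BddPos f) : BddPos fun x => ∫⁻ y, f y ∂(κ x) := by
  refine ⟨hf.1.lintegral_kernel, fun x => ?_, ?_⟩
  · exact pos_iff_ne_zero.mpr (hf.lintegral_ne (IsProbabilityMeasure.ne_zero (κ x))).1
  · obtain ⟨-, -, C, hC, hle⟩ := hf
    refine ⟨C, hC, fun x => ?_⟩
    exact (lintegral_mono hle).trans_eq (by simp)

lemma lintegral_fkTwist {X : Type*} [MeasurableSpace X] (μ : Measure X) {ψ f : X → ℝ≥0∞}
    (hψ : Measurable ψ) (hf : Measurable f) :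
    ∫⁻ x, f x ∂(fkTwist μ ψ) = (∫⁻ y, ψ y ∂μ)⁻¹ * ∫⁻ x, ψ x * f x ∂μ := by
  rw [fkTwist, lintegral_smul_measure, lintegral_withDensity_eq_lintegral_mul _ hψ hf]
  rfl

lemma measurable_fkTwist {X : Type*} [MeasurableSpace X] (κ : Kernel X X) [IsSFiniteKernel κ]
    {ψ : X → ℝ≥0∞}
    (hψ : Measurable ψ) : Measurable fun x => fkTwist (κ x) ψ := by
  refine Measure.measurable_of_measurable_coe _ fun S hS => ?_
  simp only [fkTwist, Measure.smul_apply, smul_eq_mul, withDensity_apply _ hS]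
  exact hψ.lintegral_kernel.inv.mul (hψ.setLIntegral_kernel hS)

/-- The acceptance rate of a rejection sampler between two twists of the same measure. -/
lemma lintegral_div_fkTwist {X : Type*} [MeasurableSpace X] (μ : Measure X)
    {ω ρ : X → ℝ≥0∞} (hω : BddPos ω) (hρ : BddPos ρ) :
    ∫⁻ y, ω y / ρ y ∂(fkTwist μ ρ) = (∫⁻ y, ω y ∂μ) / ∫⁻ y, ρ y ∂μ := by
  rw [lintegral_fkTwist (f := fun y => ω y / ρ y) μ hρ.1 (hω.1.div hρ.1), ENNReal.div_eq_inv_mul]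
  congr 1
  exact lintegral_congr fun x => ENNReal.mul_div_cancel (hρ.ne_zero x) (hρ.ne_top x)

/-- The updated marginals of a Feynman–Kac model are finite and nonzero. -/
lemma fkGammaHat_finite_ne_zero {X : Type*} [MeasurableSpace X] (n : ℕ)
    (M0 : Measure X) [IsProbabilityMeasure M0]
    (M : ℕ → Kernel X X) [∀ p, IsMarkovKernel (M p)] (G : ℕ → X → ℝ≥0∞)
    (hG : ∀ p ≤ n, BddPos (G p)) (p : ℕ) (hp : p ≤ n) :
    fkGammaHat M0 (fun q x => M q x) G p Set.univ ≠ 0 ∧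
      fkGammaHat M0 (fun q x => M q x) G p Set.univ ≠ ⊤ := by
  induction p with
  | zero =>
    simp only [fkGammaHat, fkGamma, withDensity_apply _ MeasurableSet.univ, Measure.restrict_univ]
    exact (hG 0 hp).lintegral_ne (IsProbabilityMeasure.ne_zero M0)
  | succ p ih =>
    obtain ⟨h0, ht⟩ := ih (by omega)
    have hmass : fkGamma M0 (fun q x => M q x) G (p + 1) Set.univ
        = fkGammaHat M0 (fun q x => M q x) G p Set.univ := by
      rw [fkGamma, Measure.bind_apply MeasurableSet.univ (M (p + 1)).measurable.aemeasurable]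
      simp [fkGammaHat]
    have : IsFiniteMeasure (fkGamma M0 (fun q x => M q x) G (p + 1)) :=
      ⟨by rw [hmass]; exact ht.lt_top⟩
    rw [fkGammaHat, withDensity_apply _ MeasurableSet.univ, Measure.restrict_univ]
    refine (hG _ hp).lintegral_ne fun h => h0 ?_
    rw [← hmass, h]
    simp

/-- Before the terminal time, the updated marginals of the `ψ`-twisted model are those of the
original model weighted by `M_{p+1}(ψ_{p+1})`. -/
lemma fkGammaHat_twist {X : Type*} [MeasurableSpace X] (n : ℕ)
    (M0 : Measure X) [IsProbabilityMeasure M0]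
    (M : ℕ → Kernel X X) [∀ p, IsMarkovKernel (M p)] (G ψ : ℕ → X → ℝ≥0∞)
    (hG : ∀ p ≤ n, BddPos (G p)) (hψ : ∀ p ≤ n, BddPos (ψ p)) (p : ℕ) (hp : p < n) :
    fkGammaHat (fkTwist M0 (ψ 0)) (fun q x => fkTwist (M q x) (ψ q))
        (fkTwG n M0 (fun q x => M q x) G ψ) p
      = (fkGammaHat M0 (fun q x => M q x) G p).withDensity
          fun x => ∫⁻ y, ψ (p + 1) y ∂(M (p + 1) x) := by
  have hs : ∀ q < n, BddPos fun x => ∫⁻ y, ψ (q + 1) y ∂(M (q + 1) x) := fun q hq =>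
    (hψ (q + 1) hq).lintegral_kernel _
  have hTw : Measurable (fkTwG n M0 (fun q x => M q x) G ψ p) := by
    unfold fkTwG
    simp only [if_pos hp]
    exact (((hG p hp.le).1.mul (hψ p hp.le).1.inv).mul (hs p hp).1).mul_const _
  have hGm := (hG p hp.le).1
  have hψm := (hψ p hp.le).1
  have hψ0 := (hψ p hp.le).ne_zero
  have hψt := (hψ p hp.le).ne_top
  have hsm := (hs p hp).1
  have hcancel (c : ℝ≥0∞) (f : X → ℝ≥0∞) (x : X)
      (hc : fkTwG n M0 (fun q x => M q x) G ψ p x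
        = G p x * (ψ p x)⁻¹ * (∫⁻ y, ψ (p + 1) y ∂(M (p + 1) x)) * c) :
      ψ p x * (fkTwG n M0 (fun q x => M q x) G ψ p x * f x)
        = c * (G p x * ((∫⁻ y, ψ (p + 1) y ∂(M (p + 1) x)) * f x)) := by
    rw [hc]
    calc _ = (ψ p x * (ψ p x)⁻¹)
          * (c * (G p x * ((∫⁻ y, ψ (p + 1) y ∂(M (p + 1) x)) * f x))) := by ring
      _ = _ := by rw [ENNReal.mul_inv_cancel (hψ0 x) (hψt x), one_mul]
  refine Measure.ext_of_lintegral _ fun f hf => ?_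
  rw [fkGammaHat, lintegral_withDensity_eq_lintegral_mul _ hTw hf,
    lintegral_withDensity_eq_lintegral_mul _ hsm hf, fkGammaHat,
    lintegral_withDensity_eq_lintegral_mul _ hGm (hsm.mul hf)]
  cases p with
  | zero =>
    obtain ⟨hc0, hct⟩ := (hψ 0 hp.le).lintegral_ne (IsProbabilityMeasure.ne_zero M0)
    simp only [fkGamma]
    rw [lintegral_fkTwist M0 hψm (hTw.mul hf),
      ← lintegral_const_mul (f := fun x => ψ 0 x * _) _ (hψm.mul (hTw.mul hf))]
    refine lintegral_congr fun x => ?_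
    simp only [Pi.mul_apply]
    rw [hcancel (∫⁻ y, ψ 0 y ∂M0) f x (by simp [fkTwG, hp]), ← mul_assoc,
      ENNReal.inv_mul_cancel hc0 hct, one_mul]
  | succ p =>
    have hp' : p < n := by omega
    have hκ := measurable_fkTwist (M (p + 1)) hψm
    have hsp := hs p hp'
    have hγ : fkGamma (fkTwist M0 (ψ 0)) (fun q x => fkTwist (M q x) (ψ q))
          (fkTwG n M0 (fun q x => M q x) G ψ) (p + 1)
        = ((fkGammaHat M0 (fun q x => M q x) G p).withDensity
            fun x => ∫⁻ y, ψ (p + 1) y ∂(M (p + 1) x)).bind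
          fun x => fkTwist (M (p + 1) x) (ψ (p + 1)) := by
      rw [← fkGammaHat_twist n M0 M G ψ hG hψ p hp']
      rfl
    have hγ' : fkGamma M0 (fun q x => M q x) G (p + 1)
        = (fkGammaHat M0 (fun q x => M q x) G p).bind (M (p + 1)) := rfl
    rw [hγ, hγ', Measure.lintegral_bind hκ.aemeasurable (hTw.mul hf).aemeasurable,
      Measure.lintegral_bind (M (p + 1)).measurable.aemeasurable
        (hGm.mul (hsm.mul hf)).aemeasurable,
      lintegral_withDensity_eq_lintegral_mul (g := fun x => ∫⁻ y, _ ∂_) _ hsp.1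
        ((Measure.measurable_lintegral (hTw.mul hf)).comp hκ)]
    refine lintegral_congr fun x => ?_
    simp only [Pi.mul_apply]
    rw [lintegral_fkTwist (f := fun y => _ * f y) _ hψm (hTw.mul hf), ← mul_assoc,
      ENNReal.mul_inv_cancel (hsp.ne_zero x) (hsp.ne_top x), one_mul]
    refine lintegral_congr fun y => ?_
    rw [hcancel 1 f y (by simp [fkTwG, hp]), one_mul]

lemma fkNorm_withDensity {X : Type*} [MeasurableSpace X] (μ : Measure X) (ψ : X → ℝ≥0∞) :
    fkNorm (μ.withDensity ψ) = fkTwist μ ψ := by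
  rw [fkNorm, fkTwist, withDensity_apply _ MeasurableSet.univ, Measure.restrict_univ]

theorem average_acceptance_rates {X : Type*} [MeasurableSpace X] (n : ℕ)
    (M0 : Measure X) [IsProbabilityMeasure M0]
    (M : ℕ → Kernel X X) [∀ p, IsMarkovKernel (M p)]
    (G ψ ω ρ : ℕ → X → ℝ≥0∞)
    (hG : ∀ p ≤ n, BddPos (G p)) (hψ : ∀ p ≤ n, BddPos (ψ p))
    (hω : ∀ p ≤ n, BddPos (ω p)) (hρ : ∀ p ≤ n, BddPos (ρ p)) :
    (∫⁻ y, ω 0 y / ρ 0 y ∂(fkTwist M0 (ρ 0))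
      = (∫⁻ y, ω 0 y ∂M0) / ∫⁻ y, ρ 0 y ∂M0) ∧
    (∀ p, 1 ≤ p → p ≤ n →
      ∫⁻ x, (∫⁻ y, ω p y / ρ p y ∂(fkTwist (M p x) (ρ p)))
          ∂(fkNorm (fkGammaHat (fkTwist M0 (ω 0)) (fun q x => fkTwist (M q x) (ω q))
              (fkTwG n M0 (fun q x => M q x) G ω) (p - 1)))
        = (∫⁻ x, (∫⁻ y, ω p y ∂(M p x)) ^ 2
              / ((∫⁻ y, ψ p y ∂(M p x)) * ∫⁻ y, ρ p y ∂(M p x))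
              ∂(fkNorm (fkGammaHat (fkTwist M0 (ψ 0)) (fun q x => fkTwist (M q x) (ψ q))
                  (fkTwG n M0 (fun q x => M q x) G ψ) (p - 1))))
          / ∫⁻ x, (∫⁻ y, ω p y ∂(M p x)) / (∫⁻ y, ψ p y ∂(M p x))
              ∂(fkNorm (fkGammaHat (fkTwist M0 (ψ 0)) (fun q x => fkTwist (M q x) (ψ q))
                  (fkTwG n M0 (fun q x => M q x) G ψ) (p - 1)))) := by
  refine ⟨lintegral_div_fkTwist M0 (hω 0 n.zero_le) (hρ 0 n.zero_le), fun p hp1 hpn => ?_⟩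
  obtain ⟨q, rfl⟩ : ∃ q, p = q + 1 := ⟨p - 1, by omega⟩
  rw [Nat.add_sub_cancel, fkGammaHat_twist n M0 M G ω hG hω q hpn,
    fkGammaHat_twist n M0 M G ψ hG hψ q hpn, fkNorm_withDensity, fkNorm_withDensity]
  simp only [lintegral_div_fkTwist _ (hω _ hpn) (hρ _ hpn)]
  obtain ⟨h0, ht⟩ := fkGammaHat_finite_ne_zero n M0 M G hG q (by omega)
  generalize fkGammaHat M0 (fun q x => M q x) G q = Γ at h0 ht ⊢
  have : IsFiniteMeasure Γ := ⟨ht.lt_top⟩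
  have hs := (hψ _ hpn).lintegral_kernel (M (q + 1))
  have hw := (hω _ hpn).lintegral_kernel (M (q + 1))
  have hr := (hρ _ hpn).lintegral_kernel (M (q + 1))
  obtain ⟨hc0, hct⟩ := hs.lintegral_ne (μ := Γ) fun h => h0 (by simp [h])
  rw [lintegral_fkTwist (f := fun x => _ / _) Γ hw.1 (hw.1.div hr.1),
    lintegral_fkTwist (f := fun x => _ ^ 2 / (_ * _)) Γ hs.1 ((hw.1.pow_const 2).div (hs.1.mul hr.1)),
    lintegral_fkTwist (f := fun x => _ / _) Γ hs.1 (hw.1.div hs.1),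
    ENNReal.mul_div_mul_left _ _ (ENNReal.inv_ne_zero.mpr hct) (ENNReal.inv_ne_top.mpr hc0),
    ENNReal.div_eq_inv_mul]
  congr 1
  · exact congrArg _ (lintegral_congr fun x =>
      (ENNReal.mul_div_cancel (hs.ne_zero x) (hs.ne_top x)).symm)
  · refine lintegral_congr fun x => ?_
    rw [← mul_div_assoc, ← mul_div_assoc, ← sq,
      ENNReal.mul_div_mul_left _ _ (hs.ne_zero x) (hs.ne_top x)]

end
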